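/- Every almost unperforated Cu-semigroup satisfying (O5) is left-soft separative. -/

import Mathlib

open Set

/-- The way-below relation: `x ≪ y` if for every increasing sequence with a
supremum dominating `y`, some term of the sequence dominates `x`. -/
def WayBelow {S : Type*} [Preorder S] (x y : S) : Prop :=
  ∀ z : ℕ → S, Monotone z → ∀ s : S, IsLUB (Set.range z) s → y ≤ s → ∃ m : ℕ, x ≤ z m

/-- A Cu-semigroup: a positively ordered commutative monoid satisfying (O1)-(O4). -/
class CuSemigroup (S : Type*) extends AddCommMonoid S, PartialOrder S where
  zero_le : ∀ x : S, 0 ≤ x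
  add_mono : ∀ {a b c d : S}, a ≤ b → c ≤ d → a + c ≤ b + d
  O1 : ∀ z : ℕ → S, Monotone z → ∃ s : S, IsLUB (Set.range z) s
  O2 : ∀ x : S, ∃ z : ℕ → S, (∀ n, WayBelow (z n) (z (n + 1))) ∧ IsLUB (Set.range z) x
  O3 : ∀ {x' x y' y : S}, WayBelow x' x → WayBelow y' y → WayBelow (x' + y') (x + y)
  O4 : ∀ (x y : ℕ → S), Monotone x → Monotone y → ∀ sx sy : S,
      IsLUB (Set.range x) sx → IsLUB (Set.range y) sy →
      IsLUB (Set.range fun n => x n + y n) (sx + sy)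

variable {S : Type*}

lemma CuSemigroup.nsmul_mono [CuSemigroup S] (x : S) : Monotone fun n : ℕ => n • x := by
  intro n m h
  obtain ⟨k, rfl⟩ := Nat.exists_eq_add_of_le h
  show n • x ≤ (n + k) • x
  rw [add_nsmul]
  calc n • x = n • x + 0 := by rw [add_zero]
    _ ≤ n • x + k • x := CuSemigroup.add_mono le_rfl (CuSemigroup.zero_le _)

/-- `infty x` is the supremum of the increasing sequence `n • x`, i.e. `∞x`. -/
noncomputable def infty [CuSemigroup S] (x : S) : S :=
  (CuSemigroup.O1 (fun n : ℕ => n • x) (CuSemigroup.nsmul_mono x)).choose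

lemma infty_isLUB [CuSemigroup S] (x : S) :
    IsLUB (Set.range fun n : ℕ => n • x) (infty x) :=
  (CuSemigroup.O1 (fun n : ℕ => n • x) (CuSemigroup.nsmul_mono x)).choose_spec

/-- An element is strongly soft if every `x' ≪ x` admits `t` with `x' + t ≪ x`
and `x' ≪ ∞t`. -/
def StronglySoft [CuSemigroup S] (x : S) : Prop :=
  ∀ x' : S, WayBelow x' x → ∃ t : S, WayBelow (x' + t) x ∧ WayBelow x' (infty t)

def SatisfiesO5 (S : Type*) [CuSemigroup S] : Prop :=
  ∀ x' x y' y z : S, WayBelow x' x → WayBelow y' y → x + y ≤ z →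
    ∃ c : S, WayBelow y' c ∧ x' + c ≤ z ∧ z ≤ x + c

def SatisfiesO6 (S : Type*) [CuSemigroup S] : Prop :=
  ∀ x' x y z : S, WayBelow x' x → WayBelow x (y + z) →
    ∃ v w : S, v ≤ x ∧ v ≤ y ∧ w ≤ x ∧ w ≤ z ∧ x' ≤ v + w

def SatisfiesO7 (S : Type*) [CuSemigroup S] : Prop :=
  ∀ x' x y' y w : S, WayBelow x' x → x ≤ w → WayBelow y' y → y ≤ w →
    ∃ z : S, WayBelow x' z ∧ WayBelow y' z ∧ z ≤ w ∧ z ≤ x + y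

def TwoOmegaDivisible (S : Type*) [CuSemigroup S] : Prop :=
  ∀ x' x : S, WayBelow x' x → ∃ y : S, 2 • y ≤ x ∧ x' ≤ infty y

def WeaklyCancellative (S : Type*) [CuSemigroup S] : Prop :=
  ∀ x y z : S, WayBelow (x + z) (y + z) → WayBelow x y

def Separative (S : Type*) [CuSemigroup S] : Prop :=
  ∀ x y t : S, WayBelow (x + t) (y + t) → WayBelow t (infty x) → WayBelow t (infty y) →
    WayBelow x y

def LeftSoftSeparative (S : Type*) [CuSemigroup S] : Prop :=
  ∀ x y t : S, StronglySoft x → WayBelow (x + t) (y + t) → WayBelow t (infty x) →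
    WayBelow t (infty y) → WayBelow x y

def AlmostUnperforated (S : Type*) [CuSemigroup S] : Prop :=
  ∀ x y : S, (∃ n : ℕ, 1 ≤ n ∧ (n + 1) • x ≤ n • y) → x ≤ y

def CountablyBased (S : Type*) [CuSemigroup S] : Prop :=
  ∃ D : Set S, D.Countable ∧
    ∀ x : S, ∃ z : ℕ → S, Monotone z ∧ (∀ n, z n ∈ D) ∧ IsLUB (Set.range z) x

/-- `Lset x` is the set `L_x = { u' : u' ≪ u ≪ x for some strongly soft u }`. -/
def Lset [CuSemigroup S] (x : S) : Set S :=
  { u' | ∃ u : S, StronglySoft u ∧ WayBelow u' u ∧ WayBelow u x }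

/-- A functional on a Cu-semigroup: a monoid morphism to `[0,∞]` preserving order
and suprema of increasing sequences. -/
structure CuFunctional (S : Type*) [CuSemigroup S] where
  toFun : S → ENNReal
  map_zero : toFun 0 = 0
  map_add : ∀ x y : S, toFun (x + y) = toFun x + toFun y
  mono : ∀ x y : S, x ≤ y → toFun x ≤ toFun y
  map_sup : ∀ z : ℕ → S, Monotone z → ∀ s : S, IsLUB (Set.range z) s →
    toFun s = ⨆ n, toFun (z n)

/-- Predicate version: `f : S → [0,∞]` is a functional on `S`. -/
def IsCuFunctional [CuSemigroup S] (f : S → ENNReal) : Prop :=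
  f 0 = 0 ∧ (∀ x y : S, f (x + y) = f x + f y) ∧ (∀ x y : S, x ≤ y → f x ≤ f y) ∧
  (∀ z : ℕ → S, Monotone z → ∀ s : S, IsLUB (Set.range z) s → f s = ⨆ n, f (z n))

/-- Least upper bound of `A` computed within the subset `T`. -/
def IsLUBIn [CuSemigroup S] (T : Set S) (A : Set S) (s : S) : Prop :=
  s ∈ T ∧ s ∈ upperBounds A ∧ ∀ b ∈ T, b ∈ upperBounds A → s ≤ b

/-- The way-below relation computed within the subset `T`. -/
def WayBelowIn [CuSemigroup S] (T : Set S) (x y : S) : Prop :=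
  ∀ z : ℕ → S, Monotone z → (∀ n, z n ∈ T) → ∀ s : S, IsLUBIn T (Set.range z) s → y ≤ s →
    ∃ m : ℕ, x ≤ z m

/-- `T` is a sub-Cu-semigroup of `S`: a submonoid which is itself a Cu-semigroup
for the inherited order, such that the inclusion preserves suprema of increasing
sequences and the way-below relation. -/
structure IsSubCuSemigroup [CuSemigroup S] (T : Set S) : Prop where
  zero_mem : (0 : S) ∈ T
  add_mem : ∀ {x y : S}, x ∈ T → y ∈ T → x + y ∈ T
  o1 : ∀ z : ℕ → S, Monotone z → (∀ n, z n ∈ T) → ∃ s : S, IsLUBIn T (Set.range z) s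
  o2 : ∀ x ∈ T, ∃ z : ℕ → S, (∀ n, z n ∈ T) ∧ (∀ n, WayBelowIn T (z n) (z (n + 1))) ∧
        IsLUBIn T (Set.range z) x
  o3 : ∀ {x' x y' y : S}, x' ∈ T → x ∈ T → y' ∈ T → y ∈ T →
        WayBelowIn T x' x → WayBelowIn T y' y → WayBelowIn T (x' + y') (x + y)
  o4 : ∀ (x y : ℕ → S), Monotone x → Monotone y → (∀ n, x n ∈ T) → (∀ n, y n ∈ T) →
        ∀ sx sy : S, IsLUBIn T (Set.range x) sx → IsLUBIn T (Set.range y) sy →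
        IsLUBIn T (Set.range fun n => x n + y n) (sx + sy)
  incl_sup : ∀ z : ℕ → S, Monotone z → (∀ n, z n ∈ T) → ∀ s : S,
        IsLUBIn T (Set.range z) s → IsLUB (Set.range z) s
  incl_wayBelow : ∀ {x y : S}, x ∈ T → y ∈ T → WayBelowIn T x y → WayBelow x y

def SatisfiesO5In [CuSemigroup S] (T : Set S) : Prop :=
  ∀ x' x y' y z : S, x' ∈ T → x ∈ T → y' ∈ T → y ∈ T → z ∈ T →
    WayBelowIn T x' x → WayBelowIn T y' y → x + y ≤ z →
    ∃ c ∈ T, WayBelowIn T y' c ∧ x' + c ≤ z ∧ z ≤ x + c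

def SatisfiesO6In [CuSemigroup S] (T : Set S) : Prop :=
  ∀ x' x y z : S, x' ∈ T → x ∈ T → y ∈ T → z ∈ T →
    WayBelowIn T x' x → WayBelowIn T x (y + z) →
    ∃ v ∈ T, ∃ w ∈ T, v ≤ x ∧ v ≤ y ∧ w ≤ x ∧ w ≤ z ∧ x' ≤ v + w

def SatisfiesO7In [CuSemigroup S] (T : Set S) : Prop :=
  ∀ x' x y' y w : S, x' ∈ T → x ∈ T → y' ∈ T → y ∈ T → w ∈ T →
    WayBelowIn T x' x → x ≤ w → WayBelowIn T y' y → y ≤ w →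
    ∃ z ∈ T, WayBelowIn T x' z ∧ WayBelowIn T y' z ∧ z ≤ w ∧ z ≤ x + y

/-- `f` is a functional on the sub-Cu-semigroup `T` (values off `T` are irrelevant). -/
def IsFunctionalOn [CuSemigroup S] (T : Set S) (f : S → ENNReal) : Prop :=
  f 0 = 0 ∧
  (∀ x ∈ T, ∀ y ∈ T, f (x + y) = f x + f y) ∧
  (∀ x ∈ T, ∀ y ∈ T, x ≤ y → f x ≤ f y) ∧
  (∀ z : ℕ → S, Monotone z → (∀ n, z n ∈ T) → ∀ s : S, IsLUBIn T (Set.range z) s →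
    f s = ⨆ n, f (z n))

/-- An element is full if `x ≤ ∞e` for every `x`. -/
def IsFull [CuSemigroup S] (e : S) : Prop := ∀ x : S, x ≤ infty e

/-- Condition (R1) for `r`: comparison of `x` with `y` whenever
`λ(x) + r·λ(e) ≤ λ(y)` for all functionals. -/
def SatisfiesR1 (S : Type*) [CuSemigroup S] (e : S) (r : NNReal) : Prop :=
  ∀ x y : S,
    (∀ lam : CuFunctional S, lam.toFun x + (r : ENNReal) * lam.toFun e ≤ lam.toFun y) → x ≤ y

/-- The radius of comparison of `(S, e)`. -/
noncomputable def rc (S : Type*) [CuSemigroup S] (e : S) : ENNReal :=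
  ⨅ r ∈ {r : NNReal | 0 < r ∧ SatisfiesR1 S e r}, (r : ENNReal)

/-- Condition (R1) for the sub-Cu-semigroup `T`. -/
def SatisfiesR1On [CuSemigroup S] (T : Set S) (e : S) (r : NNReal) : Prop :=
  ∀ x ∈ T, ∀ y ∈ T,
    (∀ f : S → ENNReal, IsFunctionalOn T f → f x + (r : ENNReal) * f e ≤ f y) → x ≤ y

/-- The radius of comparison of `(T, e)` for a sub-Cu-semigroup `T ⊆ S`. -/
noncomputable def rcOn [CuSemigroup S] (T : Set S) (e : S) : ENNReal :=
  ⨅ r ∈ {r : NNReal | 0 < r ∧ SatisfiesR1On T e r}, (r : ENNReal)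

/-- `dim S ≤ n` in the sense of covering dimension of Cu-semigroups. -/
def DimLe (S : Type*) [CuSemigroup S] (n : ℕ) : Prop :=
  ∀ (x' x : S) (r : ℕ) (y : Fin r → S), WayBelow x' x → WayBelow x (∑ j, y j) →
    ∃ z : Fin r → Fin (n + 1) → S,
      (∀ j k, WayBelow (z j k) (y j)) ∧
      WayBelow x' (∑ j, ∑ k, z j k) ∧
      (∀ k, WayBelow (∑ j, z j k) x)

/-- The covering dimension of a Cu-semigroup, in `ℕ ∪ {∞}`. -/
noncomputable def cuDim (S : Type*) [CuSemigroup S] : ℕ∞ :=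
  ⨅ n ∈ {n : ℕ | DimLe S n}, (n : ℕ∞)

/-- `dim T ≤ n` for a sub-Cu-semigroup `T ⊆ S`. -/
def DimLeOn [CuSemigroup S] (T : Set S) (n : ℕ) : Prop :=
  ∀ (x' x : S), x' ∈ T → x ∈ T → ∀ (r : ℕ) (y : Fin r → S), (∀ j, y j ∈ T) →
    WayBelowIn T x' x → WayBelowIn T x (∑ j, y j) →
    ∃ z : Fin r → Fin (n + 1) → S,
      (∀ j k, z j k ∈ T) ∧
      (∀ j k, WayBelowIn T (z j k) (y j)) ∧
      WayBelowIn T x' (∑ j, ∑ k, z j k) ∧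
      (∀ k, WayBelowIn T (∑ j, z j k) x)

/-- The covering dimension of a sub-Cu-semigroup `T ⊆ S`. -/
noncomputable def cuDimOn [CuSemigroup S] (T : Set S) : ℕ∞ :=
  ⨅ n ∈ {n : ℕ | DimLeOn T n}, (n : ℕ∞)

lemma WayBelow.le {S : Type*} [Preorder S] {x y : S} (h : WayBelow x y) : x ≤ y := by
  obtain ⟨_, hm⟩ := h (fun _ => y) monotone_const y (by simp) le_rfl
  exact hm

lemma WayBelow.trans_le {S : Type*} [Preorder S] {x y z : S} (h : WayBelow x y) (hyz : y ≤ z) :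
    WayBelow x z :=
  fun w hw s hs hzs => h w hw s hs (hyz.trans hzs)

lemma LE.le.trans_wayBelow {S : Type*} [Preorder S] {x y z : S} (hxy : x ≤ y)
    (h : WayBelow y z) : WayBelow x z := fun w hw s hs hzs =>
  (h w hw s hs hzs).imp fun _ hm => hxy.trans hm

namespace CuSemigroup

instance isOrderedAddMonoid [CuSemigroup S] : IsOrderedAddMonoid S where
  add_le_add_left _ _ h _ := CuSemigroup.add_mono h le_rfl

/-- Every element is the supremum of an increasing sequence of elements way below it. -/
lemma exists_monotone_wayBelow_isLUB [CuSemigroup S] (x : S) :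
    ∃ z : ℕ → S, Monotone z ∧ (∀ n, WayBelow (z n) x) ∧ IsLUB (Set.range z) x := by
  obtain ⟨z, hz, hx⟩ := O2 x
  exact ⟨z, monotone_nat_of_le_succ fun n => (hz n).le,
    fun n => (hz n).trans_le (hx.1 ⟨n + 1, rfl⟩), hx⟩

lemma isLUB_nsmul [CuSemigroup S] {z : ℕ → S} (hz : Monotone z) {y : S}
    (hy : IsLUB (Set.range z) y) (n : ℕ) : IsLUB (Set.range fun k => n • z k) (n • y) := by
  induction n with
  | zero => simp
  | succ n ih =>
    simpa only [succ_nsmul] using O4 _ z (fun a b h => nsmul_le_nsmul_right (hz h) n) hz _ _ ih hy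

/-- If `t ≪ ∞y` and `y` is the supremum of an increasing sequence, then `t` is dominated by a
multiple of a term of the sequence. -/
lemma exists_le_nsmul_of_wayBelow_infty [CuSemigroup S] {z : ℕ → S} (hz : Monotone z) {y t : S}
    (hy : IsLUB (Set.range z) y) (ht : WayBelow t (infty y)) : ∃ k, t ≤ k • z k := by
  have hmono : Monotone fun k => k • z k := fun a b h =>
    (nsmul_le_nsmul_right (hz h) a).trans (nsmul_mono (z b) h)
  obtain ⟨s, hs⟩ := O1 _ hmono
  refine ht _ hmono s hs ((infty_isLUB y).2 ?_)
  rintro _ ⟨n, rfl⟩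
  refine (isLUB_nsmul hz hy n).2 ?_
  rintro _ ⟨k, rfl⟩
  calc n • z k ≤ n • z (max n k) := nsmul_le_nsmul_right (hz (le_max_right _ _)) n
    _ ≤ max n k • z (max n k) := nsmul_mono _ (le_max_left _ _)
    _ ≤ s := hs.1 ⟨max n k, rfl⟩

end CuSemigroup

lemma nsmul_add_le_nsmul_add_of_add_le_add [CuSemigroup S] {x y t : S} (h : x + t ≤ y + t)
    (n : ℕ) : n • x + t ≤ n • y + t := by
  induction n with
  | zero => simp
  | succ n ih =>
    calc (n + 1) • x + t = n • x + t + x := by rw [succ_nsmul]; abel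
      _ ≤ n • y + t + x := by gcongr
      _ = n • y + (x + t) := by abel
      _ ≤ n • y + (y + t) := by gcongr
      _ = (n + 1) • y + t := by rw [succ_nsmul]; abel

/-- In an almost unperforated Cu-semigroup, a strongly soft `x` with `x + t ≤ y + t` lies below
`y` as soon as `t` is dominated by a multiple of `y`. -/
lemma StronglySoft.le_of_add_le_add [CuSemigroup S] (hau : AlmostUnperforated S) {x y t : S}
    (hx : StronglySoft x) (hxy : x + t ≤ y + t) {N : ℕ} (ht : t ≤ N • y) : x ≤ y := by
  obtain ⟨z, -, hzx, hz⟩ := CuSemigroup.exists_monotone_wayBelow_isLUB x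
  refine hz.2 ?_
  rintro _ ⟨j, rfl⟩
  obtain ⟨s, hs, hs'⟩ := hx _ (hzx j)
  obtain ⟨K, hK⟩ := hs' _ (CuSemigroup.nsmul_mono s) _ (infty_isLUB s) le_rfl
  have hK' : z j ≤ (K + 1) • s := hK.trans (CuSemigroup.nsmul_mono s K.le_succ)
  set n := (K + 1) * N + 1 with hn
  have hnx : n • x ≤ (n + N) • y :=
    calc n • x ≤ n • x + t := le_add_of_nonneg_right (CuSemigroup.zero_le t)
      _ ≤ n • y + t := nsmul_add_le_nsmul_add_of_add_le_add hxy n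
      _ ≤ n • y + N • y := by gcongr
      _ = (n + N) • y := (add_nsmul y n N).symm
  have hKx : (K + 2) • z j ≤ (K + 1) • x :=
    calc (K + 2) • z j = (K + 1) • z j + z j := succ_nsmul _ _
      _ ≤ (K + 1) • z j + (K + 1) • s := by gcongr
      _ = (K + 1) • (z j + s) := (nsmul_add _ _ _).symm
      _ ≤ (K + 1) • x := nsmul_le_nsmul_right hs.le _
  refine hau _ _ ⟨(K + 1) * (n + N), Nat.mul_pos K.succ_pos (by omega), ?_⟩
  calc ((K + 1) * (n + N) + 1) • z j = (n * (K + 2)) • z j := by congr 1; rw [hn]; ring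
    _ = n • (K + 2) • z j := mul_nsmul' _ _ _
    _ ≤ n • (K + 1) • x := nsmul_le_nsmul_right hKx n
    _ = (K + 1) • n • x := nsmul_left_comm _ _ _
    _ ≤ (K + 1) • (n + N) • y := nsmul_le_nsmul_right hnx _
    _ = ((K + 1) * (n + N)) • y := (mul_nsmul' _ _ _).symm

/-- Every almost unperforated Cu-semigroup satisfying (O5) is
left-soft separative. -/
theorem almostUnperforated_leftSoftSeparative {S : Type*} [CuSemigroup S]
    (hau : AlmostUnperforated S) (hO5 : SatisfiesO5 S) :
    LeftSoftSeparative S := by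
  intro x y t hx hxy _ hty
  obtain ⟨z, hzm, hzy, hz⟩ := CuSemigroup.exists_monotone_wayBelow_isLUB y
  obtain ⟨k, hk⟩ := hxy (fun k => z k + t) (fun a b h => add_le_add_left (hzm h) t) (y + t)
    (CuSemigroup.O4 z (fun _ => t) hzm monotone_const y t hz (by simp)) le_rfl
  obtain ⟨l, hl⟩ := CuSemigroup.exists_le_nsmul_of_wayBelow_infty hzm hz hty
  have hxz : x + t ≤ z (max k l) + t := hk.trans (by gcongr; exact hzm (le_max_left _ _))
  have htz : t ≤ l • z (max k l) :=
    hl.trans (nsmul_le_nsmul_right (hzm (le_max_right _ _)) l)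
  exact (hx.le_of_add_le_add hau hxz htz).trans_wayBelow (hzy _)
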